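/- Let D be a non-abelian p-subgroup of the finite group G with |D| = p^d (so d ≥ 3), and assume that every maximal subgroup of D is non-cyclic. Then I_{≤D}(G) · J(Z(FG))^{2p^{d−2} + p − 1 + (p^{d−1}−1)/(p−1)} = 0. -/

import Mathlib

set_option synthInstance.maxHeartbeats 1000000
set_option maxHeartbeats 1000000

open scoped Classical

/-- The class sum `K⁺ = ∑_{x ∈ K} x` of a conjugacy class `K` in the group algebra `FG`. -/
noncomputable def classSum (F : Type) [Field F] {G : Type} [Group G] [Fintype G]
    (K : ConjClasses G) : MonoidAlgebra F G :=
  ∑ x : G, if x ∈ K.carrier then MonoidAlgebra.single x (1 : F) else 0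

/-- `P` is a defect group of the conjugacy class `K`: `P` is a Sylow `p`-subgroup of the
centralizer of some element of `K`. -/
def IsClassDefectGroup {G : Type} [Group G] (p : ℕ) (P : Subgroup G) (K : ConjClasses G) : Prop :=
  ∃ x ∈ K.carrier, ∃ S : Sylow p ↥(Subgroup.centralizer {x}),
    P = Subgroup.map (Subgroup.centralizer {x}).subtype S.toSubgroup

/-- `I_P(G)`: the `F`-span of the class sums of conjugacy classes with defect group `P`. -/
noncomputable def classIdeal (F : Type) [Field F] {G : Type} [Group G] [Fintype G]
    (p : ℕ) (P : Subgroup G) : Submodule F (MonoidAlgebra F G) :=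
  Submodule.span F {a | ∃ K : ConjClasses G, IsClassDefectGroup p P K ∧ a = classSum F K}

/-- `I_{≤P}(G) = ∑_{Q ≤ P} I_Q(G)`. -/
noncomputable def classIdealLE (F : Type) [Field F] {G : Type} [Group G] [Fintype G]
    (p : ℕ) (P : Subgroup G) : Submodule F (MonoidAlgebra F G) :=
  ⨆ Q ≤ P, classIdeal F p Q

/-- `I_{<P}(G) = ∑_{Q < P} I_Q(G)`. -/
noncomputable def classIdealLT (F : Type) [Field F] {G : Type} [Group G] [Fintype G]
    (p : ℕ) (P : Subgroup G) : Submodule F (MonoidAlgebra F G) :=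
  ⨆ Q < P, classIdeal F p Q

/-- The Jacobson radical `J(Z(FG))` of the center of the group algebra, viewed as an
`F`-submodule of `FG`. -/
noncomputable def JZ (F : Type) [Field F] (G : Type) [Group G] [Fintype G] :
    Submodule F (MonoidAlgebra F G) :=
  Submodule.map (Subalgebra.center F (MonoidAlgebra F G)).val.toLinearMap
    ((Ideal.jacobson (⊥ : Ideal ↥(Subalgebra.center F (MonoidAlgebra F G)))).restrictScalars F)

section Lemmas

open scoped Pointwise

/-- The elements `a - 1`, for `a` in the group `A`. -/
def augmentationSet (F A : Type*) [Field F] [Group A] : Set (MonoidAlgebra F A) :=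
  Set.range fun a : A => MonoidAlgebra.single a 1 - 1

theorem augmentationSet_pow_subset_iff {F A : Type*} [Field F] [CommGroup A] {n : ℕ} :
    augmentationSet F A ^ n ⊆ {0} ↔ Ideal.span (augmentationSet F A) ^ n = ⊥ := by
  rw [Ideal.span, Submodule.span_pow, Submodule.span_eq_bot]
  rfl

theorem augmentationSet_pow_subset_of_le {F A : Type*} [Field F] [Group A] {m n : ℕ}
    (hmn : m ≤ n) (h : augmentationSet F A ^ m ⊆ {0}) : augmentationSet F A ^ n ⊆ {0} := by
  obtain ⟨k, rfl⟩ := Nat.exists_eq_add_of_le hmn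
  rw [pow_add]
  rintro _ ⟨x, hx, y, -, rfl⟩
  simp [Set.mem_singleton_iff.mp (h hx)]

theorem exists_commGroup_toGroup_eq (A : Type*) [h : Group A] [IsMulCommutative A] :
    ∃ i : CommGroup A, i.toGroup = h :=
  ⟨{ h with mul_comm := mul_comm' }, rfl⟩

/-- A nilpotent ideal of an `n`-dimensional commutative algebra has vanishing `n`-th power. -/
theorem Ideal.pow_finrank_eq_bot {F R : Type*} [Field F] [CommRing R] [Algebra F R]
    [FiniteDimensional F R] {I : Ideal R} (hI : IsNilpotent I) :
    I ^ Module.finrank F R = ⊥ := by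
  have key : ∀ k, I ^ k = ⊥ ∨
      Module.finrank F ((I ^ k).restrictScalars F) + k ≤ Module.finrank F R := by
    intro k
    induction k with
    | zero => right; simpa using Submodule.finrank_le _
    | succ k ih =>
      rcases ih with ih | ih
      · left; rw [pow_succ, ih]; simp
      · by_cases h : I ^ (k + 1) = I ^ k
        · left
          have : ∀ j, I ^ (k + j) = I ^ k := by
            intro j
            induction j with
            | zero => rfl
            | succ j ihj => rw [← add_assoc, pow_succ, ihj, ← pow_succ, h]
          obtain ⟨m, hm⟩ := hI
          rw [h, ← this m, pow_add, hm]; simp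
        · right
          have hlt : (I ^ (k + 1)).restrictScalars F < (I ^ k).restrictScalars F :=
            lt_of_le_of_ne (Ideal.pow_le_pow_right (Nat.le_succ k))
              fun e => h (Submodule.restrictScalars_injective F R R e)
          have := Submodule.finrank_lt_finrank_of_lt hlt
          omega
  rcases key (Module.finrank F R) with h | h
  · exact h
  · have h0 : Module.finrank F ((I ^ Module.finrank F R).restrictScalars F) = 0 := by omega
    have := Submodule.finrank_eq_zero.mp h0
    exact Submodule.restrictScalars_injective F R R this

theorem augmentationSet_pow_card_subset {F A : Type*} [Field F] [Group A] [IsMulCommutative A]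
    [Finite A] {p : ℕ} [Fact p.Prime] [CharP F p] (hA : IsPGroup p A) :
    augmentationSet F A ^ Nat.card A ⊆ {0} := by
  obtain ⟨_, rfl⟩ := exists_commGroup_toGroup_eq A
  have : Fintype A := Fintype.ofFinite A
  have b : Module.Basis A F (MonoidAlgebra F A) := .ofRepr (MonoidAlgebra.coeffLinearEquiv F)
  have : Module.Finite F (MonoidAlgebra F A) := Module.Finite.of_basis b
  have hr : Module.finrank F (MonoidAlgebra F A) = Nat.card A := by
    rw [Module.finrank_eq_nat_card_basis b]
  rw [augmentationSet_pow_subset_iff, ← hr]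
  apply Ideal.pow_finrank_eq_bot
  have : IsNoetherianRing (MonoidAlgebra F A) := isNoetherian_of_tower F inferInstance
  obtain ⟨n, hn⟩ := IsNoetherianRing.isNilpotent_nilradical (MonoidAlgebra F A)
  refine ⟨n, le_bot_iff.mp (le_trans (Ideal.pow_right_mono ?_ n) hn.le)⟩
  rw [Ideal.span_le]
  rintro _ ⟨a, rfl⟩
  obtain ⟨k, hk⟩ := hA a
  have : CharP (MonoidAlgebra F A) p := charP_of_injective_algebraMap
    (algebraMap F (MonoidAlgebra F A)).injective p
  refine ⟨p ^ k, ?_⟩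
  rw [sub_pow_char_pow, MonoidAlgebra.single_pow, hk]
  simp [MonoidAlgebra.one_def]

theorem mapDomainRingHom_single_sub_one {F A B : Type*} [Field F] [Group A] [Group B]
    (f : A →* B) (a : A) :
    MonoidAlgebra.mapDomainRingHom F f (MonoidAlgebra.single a 1 - 1) =
      MonoidAlgebra.single (f a) 1 - 1 := by
  rw [map_sub, map_one]
  simp

theorem augmentationSet_prod_pow_subset {F A B : Type*} [Field F] [CommGroup A] [CommGroup B]
    {m n : ℕ} (hA : augmentationSet F A ^ (m + 1) ⊆ {0})
    (hB : augmentationSet F B ^ (n + 1) ⊆ {0}) :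
    augmentationSet F (A × B) ^ (m + n + 1) ⊆ {0} := by
  rw [augmentationSet_pow_subset_iff] at *
  set f := MonoidAlgebra.mapDomainRingHom F (MonoidHom.inl A B)
  set g := MonoidAlgebra.mapDomainRingHom F (MonoidHom.inr A B)
  set I := (Ideal.span (augmentationSet F A)).map f
  set J := (Ideal.span (augmentationSet F B)).map g
  have hI : I ^ (m + 1) = ⊥ := by rw [← Ideal.map_pow, hA, Ideal.map_bot]
  have hJ : J ^ (n + 1) = ⊥ := by rw [← Ideal.map_pow, hB, Ideal.map_bot]
  have hle : Ideal.span (augmentationSet F (A × B)) ≤ I + J := by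
    rw [Ideal.span_le]
    rintro _ ⟨⟨a, b⟩, rfl⟩
    have e : (MonoidAlgebra.single (a, b) 1 - 1 : MonoidAlgebra F (A × B)) =
        f (MonoidAlgebra.single a 1 - 1) * MonoidAlgebra.single (1, b) 1 +
          g (MonoidAlgebra.single b 1 - 1) := by
      simp only [f, g, mapDomainRingHom_single_sub_one, sub_mul, MonoidAlgebra.single_mul_single]
      simp
    simp only [SetLike.mem_coe]
    rw [e]
    exact Submodule.add_mem_sup
      (Ideal.mul_mem_right _ _ (Ideal.mem_map_of_mem _ (Ideal.subset_span ⟨a, rfl⟩)))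
      (Ideal.mem_map_of_mem _ (Ideal.subset_span ⟨b, rfl⟩))
  have hz : (I + J) ^ (m + n + 1) = 0 := by
    rw [add_pow]
    refine Finset.sum_eq_zero fun i hi => ?_
    rcases le_or_gt (m + 1) i with h | h
    · obtain ⟨j, rfl⟩ := Nat.exists_eq_add_of_le h
      rw [pow_add, hI]; simp
    · obtain ⟨j, hj⟩ := Nat.exists_eq_add_of_le (show n + 1 ≤ m + n + 1 - i by omega)
      rw [hj, pow_add J, hJ]; simp
  exact le_bot_iff.mp ((Ideal.pow_right_mono hle _).trans hz.le)

theorem augmentationSet_pow_subset_of_hom {F A B : Type*} [Field F] [Group A] [Group B]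
    (f : A →* B) (hf : Function.Surjective f) {n : ℕ} (hA : augmentationSet F A ^ n ⊆ {0}) :
    augmentationSet F B ^ n ⊆ {0} := by
  have : augmentationSet F B = MonoidAlgebra.mapDomainRingHom F f '' augmentationSet F A := by
    ext x
    constructor
    · rintro ⟨b, rfl⟩
      obtain ⟨a, rfl⟩ := hf b
      exact ⟨_, ⟨a, rfl⟩, mapDomainRingHom_single_sub_one f a⟩
    · rintro ⟨_, ⟨a, rfl⟩, rfl⟩
      exact ⟨f a, (mapDomainRingHom_single_sub_one f a).symm⟩
  rw [this, ← Set.image_pow]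
  rintro _ ⟨x, hx, rfl⟩
  rw [hA hx]
  simp

/-- A finite non-cyclic abelian `p`-group is a direct product of two nontrivial groups. -/
theorem CommGroup.exists_nontrivial_prod_mulEquiv {A : Type*} [CommGroup A] [Finite A]
    (hA : ¬ IsCyclic A) :
    ∃ (B C : Type) (_ : CommGroup B) (_ : CommGroup C),
      Nontrivial B ∧ Nontrivial C ∧ Nonempty (A ≃* B × C) := by
  obtain ⟨ι, _, n, hn, ⟨e⟩⟩ := CommGroup.equiv_prod_multiplicative_zmod_of_finite A
  rcases isEmpty_or_nonempty ι with h | ⟨⟨i⟩⟩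
  · exfalso
    apply hA
    have := e.toEquiv.subsingleton
    infer_instance
  let e' : ((j : ι) → Multiplicative (ZMod (n j))) ≃*
      Multiplicative (ZMod (n i)) × ((j : { j // j ≠ i }) → Multiplicative (ZMod (n j))) :=
    { Equiv.piSplitAt i (fun j => Multiplicative (ZMod (n j))) with
      map_mul' := fun x y => rfl }
  have : Fact (1 < n i) := ⟨hn i⟩
  refine ⟨Multiplicative (ZMod (n i)), (j : { j // j ≠ i }) → Multiplicative (ZMod (n j)),
    inferInstance, inferInstance, inferInstance, ?_, ⟨e.trans e'⟩⟩
  by_contra hs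
  rw [not_nontrivial_iff_subsingleton] at hs
  apply hA
  let q : A ≃* Multiplicative (ZMod (n i)) := (e.trans e').trans
    { toFun := Prod.fst, invFun := fun x => (x, 1), left_inv := fun x => by
        ext : 1
        · rfl
        · exact Subsingleton.elim _ _
      right_inv := fun x => rfl, map_mul' := fun x y => rfl }
  exact isCyclic_of_surjective q.symm q.symm.surjective

theorem augmentationSet_pow_subset_of_not_isCyclic {F A : Type*} [Field F] [Group A]
    [IsMulCommutative A] [Finite A] {p n : ℕ} [Fact p.Prime] [CharP F p] (hA : ¬ IsCyclic A)
    (hcard : Nat.card A = p ^ n) : augmentationSet F A ^ (p ^ (n - 1) + p - 1) ⊆ {0} := by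
  obtain ⟨_, rfl⟩ := exists_commGroup_toGroup_eq A
  obtain ⟨B, C, _, _, _, _, ⟨e⟩⟩ := CommGroup.exists_nontrivial_prod_mulEquiv hA
  have hfin : Finite (B × C) := Finite.of_equiv A e.toEquiv
  have : Finite B := Finite.of_surjective (Prod.fst : B × C → B) Prod.fst_surjective
  have : Finite C := Finite.of_surjective (Prod.snd : B × C → C) Prod.snd_surjective
  have hpr : p.Prime := Fact.out
  have hBC : Nat.card B * Nat.card C = p ^ n := by
    rw [← Nat.card_prod, ← hcard, Nat.card_congr e.toEquiv]
  obtain ⟨b, -, hb⟩ := (Nat.dvd_prime_pow hpr).mp (Dvd.intro _ hBC)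
  obtain ⟨c, -, hc⟩ := (Nat.dvd_prime_pow hpr).mp (Dvd.intro_left _ hBC)
  have hb0 : b ≠ 0 := by
    rintro rfl
    have := Finite.one_lt_card (α := B)
    simp at hb; omega
  have hc0 : c ≠ 0 := by
    rintro rfl
    have := Finite.one_lt_card (α := C)
    simp at hc; omega
  have hn : n = b + c := by
    rw [hb, hc, ← pow_add] at hBC
    exact (Nat.pow_right_injective hpr.two_le hBC).symm
  obtain ⟨b, rfl⟩ := Nat.exists_eq_succ_of_ne_zero hb0
  obtain ⟨c, rfl⟩ := Nat.exists_eq_succ_of_ne_zero hc0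
  obtain ⟨s, hs⟩ := Nat.exists_eq_succ_of_ne_zero (pow_ne_zero (b + 1) hpr.ne_zero)
  obtain ⟨t, ht⟩ := Nat.exists_eq_succ_of_ne_zero (pow_ne_zero (c + 1) hpr.ne_zero)
  have h1 := augmentationSet_pow_card_subset (F := F) (A := B) (p := p) (IsPGroup.of_card hb)
  have h2 := augmentationSet_pow_card_subset (F := F) (A := C) (p := p) (IsPGroup.of_card hc)
  rw [hb, Nat.succ_eq_add_one, hs] at h1
  rw [hc, Nat.succ_eq_add_one, ht] at h2
  have h3 := augmentationSet_pow_subset_of_hom e.symm.toMonoidHom e.symm.surjective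
    (augmentationSet_prod_pow_subset h1 h2)
  refine augmentationSet_pow_subset_of_le ?_ h3
  have hx : 1 ≤ p ^ b := Nat.one_le_pow _ _ hpr.pos
  have hy : 1 ≤ p ^ c := Nat.one_le_pow _ _ hpr.pos
  have hbc : n - 1 = b + c + 1 := by omega
  have : p ^ (b + 1) + p ^ (c + 1) ≤ p ^ (n - 1) + p := by
    rw [hbc, pow_succ, pow_succ, pow_succ, pow_add]
    obtain ⟨x, hx⟩ := Nat.exists_eq_add_of_le hx
    obtain ⟨y, hy⟩ := Nat.exists_eq_add_of_le hy
    rw [hx, hy]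
    nlinarith [Nat.zero_le (x * y * p)]
  omega
theorem coeff_mul_eq_sum {F G : Type*} [Field F] [Group G] [Fintype G] (a b : MonoidAlgebra F G)
    (g : G) : (a * b).coeff g = ∑ x, a.coeff x * b.coeff (x⁻¹ * g) := by
  rw [MonoidAlgebra.coeff_mul_apply_left, Finsupp.sum_fintype _ _ (by simp)]

/-- In the group algebra of a finite group, the trace of any element is annihilated by every
central nilpotent element. -/
theorem sum_conj_mul_eq_zero {F Q : Type*} [Field F] [Group Q] [Fintype Q]
    (y z : MonoidAlgebra F Q) (hz : ∀ w, Commute z w) (hnil : IsNilpotent z) :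
    (∑ q : Q, MonoidAlgebra.single q 1 * y * MonoidAlgebra.single q⁻¹ 1) * z = 0 := by
  ext g
  have hL : IsNilpotent (LinearMap.mulLeft F (y * z) *
      LinearMap.mulRight F (MonoidAlgebra.single g⁻¹ (1 : F))) := by
    refine (LinearMap.commute_mulLeft_right (R := F) (y * z) _).isNilpotent_mul_right ?_
    rw [LinearMap.isNilpotent_mulLeft_iff]
    exact (hz y).symm.isNilpotent_mul_left hnil
  have htr := (LinearMap.isNilpotent_trace_of_isNilpotent hL).eq_zero
  rw [LinearMap.trace_eq_matrix_trace F
    (Module.Basis.ofRepr (MonoidAlgebra.coeffLinearEquiv F) :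
      Module.Basis Q F (MonoidAlgebra F Q)), Matrix.trace] at htr
  have key : ∀ q : Q, (MonoidAlgebra.single q 1 * y * MonoidAlgebra.single q⁻¹ 1 * z).coeff g =
      (y * z).coeff (q⁻¹ * g * q) := by
    intro q
    rw [mul_assoc, (hz (MonoidAlgebra.single q⁻¹ 1)).symm.eq, ← mul_assoc, mul_assoc _ y z,
      MonoidAlgebra.coeff_mul_single_apply, MonoidAlgebra.coeff_single_mul_apply]
    simp [mul_assoc]
  rw [Finset.sum_mul, MonoidAlgebra.coeff_sum, Finset.sum_congr rfl fun q _ => rfl,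
    Finsupp.finsetSum_apply, Finset.sum_congr rfl fun q _ => key q,
    ← Equiv.sum_comp (Equiv.inv Q)]
  refine Eq.trans (Finset.sum_congr rfl fun q _ => ?_) htr
  simp [LinearMap.toMatrix_apply, MonoidAlgebra.coeffLinearEquiv,
    ← mul_assoc, MonoidAlgebra.coeff_mul_single_apply]

/-- Modulo `p`, a sum of an invariant function is the sum over the fixed points of a `p`-group. -/
theorem IsPGroup.sum_eq_sum_fixedPoints {F P α : Type*} [Field F] [Group P] [MulAction P α]
    [Fintype α] [Finite P] {p : ℕ} [Fact p.Prime] [CharP F p] (hP : IsPGroup p P) (f : α → F)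
    (hf : ∀ (g : P) a, f (g • a) = f a) :
    ∑ a, f a = ∑ a ∈ Finset.univ.filter (· ∈ MulAction.fixedPoints P α), f a := by
  have h1 : ∀ s : Finset α, ∑ a ∈ s, f a =
      ∑ c ∈ Finset.univ.image f, ((s.filter fun a => f a = c).card : F) * c := by
    intro s
    rw [← Finset.sum_fiberwise_of_maps_to (t := Finset.univ.image f) (g := f)
      (fun a _ => Finset.mem_image_of_mem f (Finset.mem_univ a))]
    refine Finset.sum_congr rfl fun c _ => ?_
    rw [Finset.sum_congr rfl fun a ha => (Finset.mem_filter.mp ha).2, Finset.sum_const,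
      nsmul_eq_mul]
  rw [h1, h1]
  refine Finset.sum_congr rfl fun c _ => ?_
  congr 1
  let X : SubMulAction P α := ⟨{a | f a = c}, fun g a (ha : f a = c) => (hf g a).trans ha⟩
  have h2 := hP.card_modEq_card_fixedPoints X
  have h3 : Nat.card X = (Finset.univ.filter fun a => f a = c).card := by
    rw [show Nat.card X = Nat.card {a // f a = c} from rfl, Nat.card_eq_fintype_card,
      Fintype.card_subtype]
  have h4 : Nat.card (MulAction.fixedPoints P X) =
      ((Finset.univ.filter (· ∈ MulAction.fixedPoints P α)).filter fun a => f a = c).card := by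
    rw [Finset.filter_filter, ← Fintype.card_subtype, ← Nat.card_eq_fintype_card]
    exact Nat.card_congr
      { toFun := fun x => ⟨x.1.1, fun g => congrArg Subtype.val (x.2 g), x.1.2⟩
        invFun := fun x => ⟨⟨x.1, x.2.2⟩, fun g => Subtype.ext (x.2.1 g)⟩
        left_inv := fun x => rfl
        right_inv := fun x => rfl }
  rw [← h3, ← h4]
  exact (CharP.natCast_eq_natCast F p).mpr h2

theorem exists_pPart_exponent (H : Type*) [Group H] [Finite H] (p : ℕ) [Fact p.Prime] :
    ∃ l : ℕ, (∀ x : H, ∃ k, (x ^ l) ^ p ^ k = 1) ∧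
      ∀ u : H, (∃ k, u ^ p ^ k = 1) → u ^ l = u := by
  obtain ⟨n, m, hm, hc⟩ := Nat.exists_eq_pow_mul_and_not_dvd (Nat.card_pos (α := H)).ne' p
    (Fact.out : p.Prime).ne_one
  have hcop : (p ^ n).Coprime m :=
    Nat.Coprime.pow_left n ((Nat.Prime.coprime_iff_not_dvd Fact.out).mpr hm)
  obtain ⟨l, hl1, hl2⟩ := Nat.chineseRemainder hcop 1 0
  refine ⟨l, fun x => ⟨n, ?_⟩, fun u ⟨k, hk⟩ => ?_⟩
  · rw [← pow_mul]
    refine orderOf_dvd_iff_pow_eq_one.mp ((orderOf_dvd_natCard x).trans ?_)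
    rw [hc, mul_comm]
    exact mul_dvd_mul_right ((Nat.modEq_zero_iff_dvd).mp hl2) _
  · have h1 : orderOf u ∣ p ^ n := by
      have h2 : (orderOf u).Coprime m := by
        refine Nat.Coprime.coprime_dvd_left (orderOf_dvd_of_pow_eq_one hk) ?_
        exact Nat.Coprime.pow_left k ((Nat.Prime.coprime_iff_not_dvd Fact.out).mpr hm)
      exact h2.dvd_of_dvd_mul_right (hc ▸ orderOf_dvd_natCard u)
    conv_rhs => rw [← pow_one u]
    exact pow_eq_pow_iff_modEq.mpr (hl1.of_dvd h1)
/-- The central elements of the group algebra that are supported on `S`. -/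
noncomputable def centralSupported (F : Type*) {G : Type*} [Field F] [Group G] (S : Set G) :
    Submodule F (MonoidAlgebra F G) where
  carrier := {a | (∀ g h, a.coeff (h * g * h⁻¹) = a.coeff g) ∧ ∀ g, a.coeff g ≠ 0 → g ∈ S}
  zero_mem' := by simp
  add_mem' := by
    rintro a b ⟨ha, ha'⟩ ⟨hb, hb'⟩
    refine ⟨fun g h => by simp [ha, hb], fun g hg => ?_⟩
    by_contra hgS
    have h1 := not_imp_comm.mp (ha' g) hgS
    have h2 := not_imp_comm.mp (hb' g) hgS
    exact hg (by simp [h1, h2])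
  smul_mem' := by
    rintro c a ⟨ha, ha'⟩
    refine ⟨fun g h => by simp [ha], fun g hg => ha' g fun h0 => hg (by simp [h0])⟩

/-- The span of the central nilpotent elements of the group algebra. -/
noncomputable def centralNilpotents (F G : Type*) [Field F] [Group G] :
    Submodule F (MonoidAlgebra F G) :=
  Submodule.span F {z | (∀ w, Commute z w) ∧ IsNilpotent z}

theorem coeff_conj_of_commute {F G : Type*} [Field F] [Group G] {a : MonoidAlgebra F G}
    (ha : ∀ w, Commute a w) (g h : G) : a.coeff (h * g * h⁻¹) = a.coeff g := by
  have := congrArg (fun w => w.coeff (h * g)) (ha (MonoidAlgebra.single h 1)).eq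
  simpa [MonoidAlgebra.coeff_mul_single_apply, MonoidAlgebra.coeff_single_mul_apply] using this

theorem commute_of_coeff_conj {F G : Type*} [Field F] [Group G] {a : MonoidAlgebra F G}
    (ha : ∀ g h, a.coeff (h * g * h⁻¹) = a.coeff g) (w : MonoidAlgebra F G) : Commute a w := by
  induction w using MonoidAlgebra.induction_linear with
  | zero => exact Commute.zero_right a
  | add x y hx hy => exact hx.add_right hy
  | single h r =>
    ext g
    rw [MonoidAlgebra.coeff_mul_single_apply, MonoidAlgebra.coeff_single_mul_apply,
      ← ha (h⁻¹ * g) h, mul_comm]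
    simp

theorem commute_of_mem_centralSupported {F G : Type*} [Field F] [Group G] {S : Set G}
    {a : MonoidAlgebra F G} (ha : a ∈ centralSupported F S) (w : MonoidAlgebra F G) :
    Commute a w := commute_of_coeff_conj ha.1 w

theorem coeff_classSum (F : Type) [Field F] {G : Type} [Group G] [Fintype G] (K : ConjClasses G)
    (g : G) : (classSum F K).coeff g = if ConjClasses.mk g = K then 1 else 0 := by
  have : ∀ x : G, ((if x ∈ K.carrier then MonoidAlgebra.single x (1 : F) else 0).coeff g) =
      if g = x then (if x ∈ K.carrier then (1 : F) else 0) else 0 := by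
    intro x
    by_cases hx : x ∈ K.carrier <;> simp [hx, Finsupp.single_apply, eq_comm]
  rw [classSum, MonoidAlgebra.coeff_sum, Finsupp.finsetSum_apply,
    Finset.sum_congr rfl fun x _ => this x]
  simp [ConjClasses.mem_carrier_iff_mk_eq]

/-- A central element is a linear combination of class sums. -/
theorem eq_sum_classSum {F : Type} [Field F] {G : Type} [Group G] [Fintype G]
    {a : MonoidAlgebra F G} (ha : ∀ g h, a.coeff (h * g * h⁻¹) = a.coeff g) :
    a = ∑ K : ConjClasses G, a.coeff (Quotient.out K) • classSum F K := by
  ext g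
  simp only [MonoidAlgebra.coeff_sum, Finsupp.finsetSum_apply, MonoidAlgebra.coeff_smul_apply,
    coeff_classSum, smul_eq_mul, mul_ite, mul_one, mul_zero, Finset.sum_ite_eq,
    Finset.mem_univ, if_true]
  obtain ⟨c, hc⟩ := isConj_iff.mp (ConjClasses.mk_eq_mk_iff_isConj.mp
    (Quotient.out_eq (ConjClasses.mk g)))
  conv_lhs => rw [← hc, ha]

/-- The elements of `H` all of whose centralizing `p`-elements lie in `Z`. -/
def centralDefectSet {H : Type*} [Group H] (p : ℕ) (Z : Subgroup H) : Set H :=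
  {x | ∀ h, Commute h x → (∃ k, h ^ p ^ k = 1) → h ∈ Z}

/-- The `F`-span of the elements `u - 1` with `u ∈ Z`. -/
noncomputable def augmentationSpan (F : Type*) {H : Type*} [Field F] [Group H] (Z : Subgroup H) :
    Submodule F (MonoidAlgebra F H) :=
  Submodule.span F (Set.range fun u : Z => MonoidAlgebra.single (u : H) 1 - 1)

theorem mem_augmentationSpan_mul {F H : Type*} [Field F] [Group H] [Fintype H] {p : ℕ}
    [Fact p.Prime] {Z : Subgroup H} (hZp : IsPGroup p Z) (hZc : ∀ u ∈ Z, ∀ h, Commute u h)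
    {a : MonoidAlgebra F H} (ha : a ∈ centralSupported F (centralDefectSet p Z))
    (ha0 : ∀ x, ∑ u : Z, a.coeff (u * x) = 0) :
    a ∈ augmentationSpan F Z * centralSupported F (centralDefectSet p Z) := by
  obtain ⟨l, hl1, hl2⟩ := exists_pPart_exponent H p
  have hlu : ∀ u ∈ Z, u ^ l = u := fun u hu => hl2 u <| by
    obtain ⟨k, hk⟩ := hZp ⟨u, hu⟩
    exact ⟨k, congrArg Subtype.val hk⟩
  have hlm : ∀ u ∈ Z, ∀ x, (u * x) ^ l = u * x ^ l := fun u hu x => by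
    rw [(hZc u hu x).mul_pow, hlu u hu]
  let m : Z → MonoidAlgebra F H := fun u =>
    MonoidAlgebra.ofCoeff (Finsupp.equivFunOnFinite.symm fun x =>
      if x ^ l = 1 then a.coeff (u * x) else 0)
  have hm : ∀ u x, (m u).coeff x = if x ^ l = 1 then a.coeff (u * x) else 0 := fun u x => rfl
  have hmem : ∀ u, m u ∈ centralSupported F (centralDefectSet p Z) := by
    intro u
    refine ⟨fun g h => ?_, fun g hg h hhg hp => ?_⟩
    · rw [hm, hm, conj_pow, conj_eq_one_iff]
      congr 1
      rw [← ha.1 (u * g) h, show h * (u * g) * h⁻¹ = (h * u) * g * h⁻¹ by group,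
        ← (hZc u u.2 h).eq]
      congr 1; group
    · rw [hm] at hg
      refine ha.2 (u * g) (fun h0 => hg (by simp [h0])) h ?_ hp
      exact (hZc u u.2 h).symm.mul_right hhg
  have hsum : a = ∑ u : Z, (MonoidAlgebra.single (u : H) 1 - 1) * m u := by
    ext x
    have h1 : ∀ u : Z, ((MonoidAlgebra.single (u : H) 1 - 1) * m u).coeff x =
        (if (u : H) = x ^ l then a.coeff x else 0) -
          if x ^ l = 1 then a.coeff (u * x) else 0 := by
      intro u
      rw [sub_mul, one_mul, MonoidAlgebra.coeff_sub, Finsupp.sub_apply,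
        MonoidAlgebra.coeff_single_mul_apply, one_mul, hm, hm, hlm _ (Z.inv_mem u.2),
        inv_mul_eq_one, mul_inv_cancel_left]
    rw [MonoidAlgebra.coeff_sum, Finsupp.finsetSum_apply, Finset.sum_congr rfl fun u _ => h1 u,
      Finset.sum_sub_distrib]
    have h2 : ∑ u : Z, (if x ^ l = 1 then a.coeff (u * x) else 0) = 0 := by
      split_ifs
      · exact ha0 x
      · simp
    rw [h2, sub_zero]
    by_cases hx : a.coeff x = 0
    · simp [hx]
    · have hxZ : x ^ l ∈ Z := ha.2 x hx _ (Commute.pow_left rfl l) (hl1 x)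
      rw [Finset.sum_eq_single ⟨_, hxZ⟩]
      · simp
      · intro u _ hu
        rw [if_neg fun e => hu (Subtype.ext e)]
      · simp
  rw [hsum]
  exact Submodule.sum_mem _ fun u _ =>
    Submodule.mul_mem_mul (Submodule.subset_span ⟨u, rfl⟩) (hmem u)

theorem sum_coeff_coset_eq_zero {F H : Type*} [Field F] [Group H] [Fintype H]
    {Z : Subgroup H} [Z.Normal] {a : MonoidAlgebra F H}
    (ha : MonoidAlgebra.mapDomainRingHom F (QuotientGroup.mk' Z) a = 0) (x : H) :
    ∑ u : Z, a.coeff (u * x) = 0 := by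
  have h1 : ∀ b : MonoidAlgebra F H,
      (MonoidAlgebra.mapDomainRingHom F (QuotientGroup.mk' Z) b).coeff (x : H ⧸ Z) =
        ∑ u : Z, b.coeff (u * x) := by
    intro b
    induction b using MonoidAlgebra.induction_linear with
    | zero => simp
    | add b c hb hc =>
      rw [map_add, MonoidAlgebra.coeff_add, Finsupp.add_apply, hb, hc]
      simp [Finset.sum_add_distrib]
    | single h r =>
      have h2 : ∀ u : Z, (MonoidAlgebra.single h r).coeff ((u : H) * x) =
          if (u : H) = h * x⁻¹ then r else 0 := by
        intro u
        simp only [MonoidAlgebra.coeff_single, Finsupp.single_apply, eq_mul_inv_iff_mul_eq, eq_comm]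
      rw [Finset.sum_congr rfl fun u _ => h2 u]
      have h3 : (MonoidAlgebra.mapDomainRingHom F (QuotientGroup.mk' Z)
          (MonoidAlgebra.single h r)).coeff (x : H ⧸ Z) = if h * x⁻¹ ∈ Z then r else 0 := by
        have h4 : ((h : H ⧸ Z) = x) ↔ h * x⁻¹ ∈ Z := by
          rw [← QuotientGroup.eq_one_iff, QuotientGroup.mk_mul, QuotientGroup.mk_inv,
            mul_inv_eq_one]
        rw [← if_congr h4 rfl rfl]
        simp [Finsupp.single_apply]
      rw [h3]
      by_cases h4 : h * x⁻¹ ∈ Z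
      · rw [if_pos h4, Finset.sum_eq_single ⟨_, h4⟩]
        · simp
        · intro u _ hu
          rw [if_neg fun e => hu (Subtype.ext e)]
        · simp
      · rw [if_neg h4, Finset.sum_eq_zero]
        intro u _
        rw [if_neg]
        rintro e
        exact h4 (e ▸ u.2)
  rw [← h1, ha]
  simp

section CentralDefect

variable {F : Type} [Field F] {H : Type} [Group H] [Fintype H] {p : ℕ} [Fact p.Prime] [CharP F p]
  {Z : Subgroup H}

theorem exists_smul_classSum_eq_sum [Z.Normal] (hZp : IsPGroup p Z)
    (hZc : ∀ u ∈ Z, ∀ h, Commute u h)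
    {y : H}
    (hy : y ∈ centralDefectSet p Z) :
    ∃ n : F, n ≠ 0 ∧ n • classSum F (ConjClasses.mk y) =
      ∑ q : H ⧸ Z, MonoidAlgebra.single (q.out * y * q.out⁻¹) 1 := by
  have hφ : ∀ h : H, (h : H ⧸ Z).out * y * (h : H ⧸ Z).out⁻¹ = h * y * h⁻¹ := by
    intro h
    obtain ⟨⟨u, hu⟩, hu'⟩ := QuotientGroup.mk_out_eq_mul Z h
    rw [hu']
    calc h * u * y * (h * u)⁻¹ = h * (u * y * u⁻¹) * h⁻¹ := by group
      _ = h * y * h⁻¹ := by rw [(hZc u hu y).eq, mul_inv_cancel_right]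
  let T : Subgroup (H ⧸ Z) := (Subgroup.centralizer {y}).map (QuotientGroup.mk' Z)
  have hT : ∀ h : H, (h : H ⧸ Z) ∈ T ↔ h * y * h⁻¹ = y := by
    intro h
    constructor
    · rintro ⟨c, hc, hch⟩
      rw [← hφ h, show (h : H ⧸ Z) = (c : H ⧸ Z) from hch.symm, hφ c]
      rw [mul_inv_eq_iff_eq_mul]
      exact (Subgroup.mem_centralizer_singleton_iff.mp hc)
    · intro hh
      exact ⟨h, Subgroup.mem_centralizer_singleton_iff.mpr (mul_inv_eq_iff_eq_mul.mp hh), rfl⟩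
  refine ⟨(Nat.card T : F), ?_, ?_⟩
  · rw [Ne, CharP.cast_eq_zero_iff F p]
    intro hdvd
    obtain ⟨⟨q, c, hc, rfl⟩, hq⟩ := exists_prime_orderOf_dvd_card' p hdvd
    have hcp : c ^ p ∈ Z := by
      have := pow_orderOf_eq_one (⟨QuotientGroup.mk' Z c, ⟨c, hc, rfl⟩⟩ : T)
      rw [hq] at this
      have := congrArg Subtype.val this
      exact (QuotientGroup.eq_one_iff _).mp (by simpa using this)
    obtain ⟨k, hk⟩ := hZp ⟨_, hcp⟩
    have hcZ : c ∈ Z := by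
      refine hy c (Subgroup.mem_centralizer_singleton_iff.mp hc) ⟨k + 1, ?_⟩
      rw [pow_succ', pow_mul]
      exact congrArg Subtype.val hk
    have h1 : (⟨QuotientGroup.mk' Z c, ⟨c, hc, rfl⟩⟩ : T) = 1 :=
      Subtype.ext ((QuotientGroup.eq_one_iff _).mpr hcZ)
    rw [h1, orderOf_one] at hq
    exact (Fact.out : p.Prime).one_lt.ne hq
  · ext k
    have h1 : ∀ q : H ⧸ Z, (MonoidAlgebra.single (q.out * y * q.out⁻¹) (1 : F)).coeff k =
        if q.out * y * q.out⁻¹ = k then 1 else 0 := fun q => by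
      simp [Finsupp.single_apply]
    rw [MonoidAlgebra.coeff_smul_apply, coeff_classSum, MonoidAlgebra.coeff_sum,
      Finsupp.finsetSum_apply, Finset.sum_congr rfl fun q _ => h1 q, Finset.sum_boole]
    by_cases hk : ConjClasses.mk k = ConjClasses.mk y
    · obtain ⟨h, rfl⟩ := isConj_iff.mp (ConjClasses.mk_eq_mk_iff_isConj.mp hk.symm)
      rw [if_pos hk, smul_eq_mul, mul_one, ← Fintype.card_subtype, ← Nat.card_eq_fintype_card]
      congr 1
      refine Nat.card_congr ((Equiv.mulLeft (h : H ⧸ Z)).subtypeEquiv fun q => ?_)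
      induction q using QuotientGroup.induction_on with
      | H c =>
        rw [hT, Equiv.coe_mulLeft]
        change _ ↔ (((h * c : H) : H ⧸ Z).out * y * ((h * c : H) : H ⧸ Z).out⁻¹) = _
        rw [hφ, mul_inv_rev,
          show h * c * y * (c⁻¹ * h⁻¹) = h * (c * y * c⁻¹) * h⁻¹ by group]
        simp
    · rw [if_neg hk, Finset.filter_false_of_mem]
      · simp
      · intro q _ hq
        exact hk (ConjClasses.mk_eq_mk_iff_isConj.mpr (isConj_iff.mpr ⟨_, hq⟩).symm)

/-- Central elements supported on elements of defect `Z` are mapped into the trace ideal of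
`F[H/Z]`, so their products with nilpotent central elements vanish there. -/
theorem mapDomain_mul_eq_zero [Z.Normal] (hZp : IsPGroup p Z) (hZc : ∀ u ∈ Z, ∀ h, Commute u h)
    {a z : MonoidAlgebra F H} (ha : a ∈ centralSupported F (centralDefectSet p Z))
    (hz : ∀ w, Commute z w) (hnil : IsNilpotent z) :
    MonoidAlgebra.mapDomainRingHom F (QuotientGroup.mk' Z) (a * z) = 0 := by
  set π := MonoidAlgebra.mapDomainRingHom F (QuotientGroup.mk' Z) with hπ
  have hπs : ∀ (h : H) (r : F), π (MonoidAlgebra.single h r) =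
      MonoidAlgebra.single (h : H ⧸ Z) r := fun h r => by simp [hπ]
  have hzc : ∀ w, Commute (π z) w := by
    intro w
    induction w using MonoidAlgebra.induction_linear with
    | zero => exact Commute.zero_right _
    | add x y hx hy => exact hx.add_right hy
    | single q r =>
      induction q using QuotientGroup.induction_on with
      | H c => rw [← hπs]; exact (hz _).map π
  have key : ∀ y ∈ centralDefectSet p Z, π (classSum F (ConjClasses.mk y)) * π z = 0 := by
    intro y hy
    obtain ⟨n, hn, hny⟩ := exists_smul_classSum_eq_sum (F := F) hZp hZc hy
    have h1 := sum_conj_mul_eq_zero (MonoidAlgebra.single (y : H ⧸ Z) 1) (π z) hzc (hnil.map π)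
    have h2 : π (n • classSum F (ConjClasses.mk y)) * π z = 0 := by
      rw [hny, map_sum, ← h1]
      congr 1
      refine Finset.sum_congr rfl fun q _ => ?_
      rw [hπs, MonoidAlgebra.single_mul_single, MonoidAlgebra.single_mul_single]
      simp
    have h3 : π (n • classSum F (ConjClasses.mk y)) = n • π (classSum F (ConjClasses.mk y)) :=
      map_smul (MonoidAlgebra.mapDomainAlgHom F F (QuotientGroup.mk' Z)) n _
    rw [h3, smul_mul_assoc] at h2
    exact (smul_eq_zero.mp h2).resolve_left hn
  rw [map_mul, eq_sum_classSum ha.1, map_sum, Finset.sum_mul]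
  refine Finset.sum_eq_zero fun K _ => ?_
  by_cases h0 : a.coeff (Quotient.out K) = 0
  · rw [h0]; simp
  · have h3 : π (a.coeff (Quotient.out K) • classSum F K) =
        a.coeff (Quotient.out K) • π (classSum F K) :=
      map_smul (MonoidAlgebra.mapDomainAlgHom F F (QuotientGroup.mk' Z)) _ _
    have := key _ (ha.2 _ h0)
    rw [show ConjClasses.mk (Quotient.out K) = K from Quotient.out_eq K] at this
    rw [h3, smul_mul_assoc, this, smul_zero]

end CentralDefect
/-- The Brauer congruence: at an element centralized by the `p`-subgroup `P`, the product of two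
central elements only depends on the coefficients on the centralizer of `P`. -/
theorem coeff_mul_eq_sum_centralizer {F G : Type*} [Field F] [Group G] [Fintype G] {p : ℕ}
    [Fact p.Prime] [CharP F p] {P : Subgroup G} (hP : IsPGroup p P) {a b : MonoidAlgebra F G}
    (ha : ∀ w, Commute a w) (hb : ∀ w, Commute b w) {g : G} (hg : ∀ q ∈ P, Commute q g) :
    (a * b).coeff g =
      ∑ x ∈ Finset.univ.filter (fun x => ∀ q ∈ P, Commute q x), a.coeff x * b.coeff (x⁻¹ * g) := by
  let _ : MulAction P G := MulAction.compHom G ((MulAut.conj (G := G)).comp P.subtype)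
  have hs : ∀ (q : P) (x : G), q • x = q * x * (q : G)⁻¹ := fun q x => rfl
  rw [coeff_mul_eq_sum, hP.sum_eq_sum_fixedPoints]
  · congr 1
    ext x
    simp only [Finset.mem_filter, Finset.mem_univ, true_and, MulAction.mem_fixedPoints, hs,
      Subtype.forall, mul_inv_eq_iff_eq_mul]
    rfl
  · intro q x
    rw [hs, coeff_conj_of_commute ha]
    congr 1
    rw [← coeff_conj_of_commute hb (x⁻¹ * g) q]
    congr 1
    have : (q : G) * g = g * q := (hg q q.2).eq
    calc ((q : G) * x * (q : G)⁻¹)⁻¹ * g = q * x⁻¹ * (q : G)⁻¹ * (g * q) * (q : G)⁻¹ := by group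
      _ = q * (x⁻¹ * g) * (q : G)⁻¹ := by rw [← this]; group

theorem mul_mem_centralSupported {F G : Type*} [Field F] [Group G] [Fintype G] {p : ℕ}
    [Fact p.Prime] [CharP F p] {S : Set G}
    (hS : ∀ x ∈ S, ∀ g, ∀ Q : Sylow p (Subgroup.centralizer {g}),
      (∀ q ∈ Q, Commute (q : G) x) → g ∈ S)
    {a b : MonoidAlgebra F G} (ha : a ∈ centralSupported F S) (hb : ∀ w, Commute b w) :
    a * b ∈ centralSupported F S := by
  have hac := commute_of_mem_centralSupported ha
  refine ⟨coeff_conj_of_commute fun w => (hac w).mul_left (hb w), fun g hg => ?_⟩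
  obtain ⟨Q⟩ : Nonempty (Sylow p (Subgroup.centralizer {g})) := inferInstance
  rw [coeff_mul_eq_sum_centralizer (P := Q.toSubgroup.map (Subgroup.subtype _)) (p := p)
    (Q.isPGroup'.map _) hac hb] at hg
  · obtain ⟨x, hx, hx0⟩ := Finset.exists_ne_zero_of_sum_ne_zero hg
    rw [Finset.mem_filter] at hx
    exact hS x (ha.2 x (left_ne_zero_of_mul hx0)) g Q fun q hq => hx.2 q ⟨q, hq, rfl⟩
  · rintro _ ⟨q, -, rfl⟩
    exact Subgroup.mem_centralizer_singleton_iff.mp q.2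

theorem centralDefectSet_of_sylow {G : Type*} [Group G] [Finite G] {p : ℕ} [Fact p.Prime]
    {Z : Subgroup G} (hZc : ∀ u ∈ Z, ∀ h, Commute u h) :
    ∀ x ∈ centralDefectSet p Z, ∀ g, ∀ Q : Sylow p (Subgroup.centralizer {g}),
      (∀ q ∈ Q, Commute (q : G) x) → g ∈ centralDefectSet p Z := by
  intro x hx g Q hQ h hhg ⟨k, hk⟩
  let h' : Subgroup.centralizer {g} := ⟨h, Subgroup.mem_centralizer_singleton_iff.mpr hhg⟩
  have hp : IsPGroup p (Subgroup.zpowers h') := by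
    rintro ⟨_, m, rfl⟩
    refine ⟨k, Subtype.ext ?_⟩
    change (h' ^ m) ^ p ^ k = 1
    rw [← zpow_natCast, zpow_comm, zpow_natCast,
      show h' ^ p ^ k = 1 from Subtype.ext hk, one_zpow]
  obtain ⟨R, hR⟩ := hp.exists_le_sylow
  obtain ⟨c, hc⟩ := MulAction.exists_smul_eq (Subgroup.centralizer {g}) R Q
  have hcQ : c * h' * c⁻¹ ∈ Q := by
    rw [← hc]
    exact Subgroup.smul_mem_pointwise_smul h' (MulAut.conj c) _ (hR (Subgroup.mem_zpowers h'))
  have h1 : (c * h * (c : G)⁻¹) ∈ Z := by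
    refine hx _ (hQ _ hcQ) ⟨k, ?_⟩
    rw [conj_pow, hk]
    simp
  have h2 := hZc _ h1 (c : G)⁻¹
  have h3 : h = c * h * (c : G)⁻¹ := by
    have := h2.eq
    calc h = (c : G)⁻¹ * (c * h * (c : G)⁻¹) * c := by group
      _ = _ := by rw [← h2.eq]; group
  rw [h3]; exact h1

theorem Submodule.mul_span_le_of_forall {F A : Type*} [CommSemiring F] [Semiring A] [Algebra F A]
    {M N : Submodule F A} {T : Set A} (h : ∀ a ∈ M, ∀ t ∈ T, a * t ∈ N) :
    M * Submodule.span F T ≤ N := by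
  rw [Submodule.mul_le]
  intro a ha t ht
  induction ht using Submodule.span_induction with
  | mem t ht => exact h a ha t ht
  | zero => simp
  | add x y _ _ hx hy => rw [mul_add]; exact N.add_mem hx hy
  | smul c x _ hx => rw [mul_smul_comm]; exact N.smul_mem c hx

/-- If the `n`-th power of the augmentation ideal of a central `p`-subgroup `Z` vanishes, then the
central elements supported on elements of defect `Z` are annihilated by `n`-fold products of
nilpotent central elements. -/
theorem centralSupported_mul_pow_eq_bot {F : Type} [Field F] {H : Type} [Group H] [Fintype H]
    {p : ℕ} [Fact p.Prime] [CharP F p] {Z : Subgroup H} (hZp : IsPGroup p Z)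
    (hZc : ∀ u ∈ Z, ∀ h, Commute u h) {n : ℕ} (hn : augmentationSet F Z ^ n ⊆ {0}) :
    centralSupported F (centralDefectSet p Z) * centralNilpotents F H ^ n = ⊥ := by
  set M := centralSupported F (centralDefectSet p Z)
  have : Z.Normal := ⟨fun u hu g => by
    rw [← (hZc u hu g).eq, mul_inv_cancel_right]; exact hu⟩
  have h1 : M * centralNilpotents F H ≤ augmentationSpan F Z * M := by
    refine Submodule.mul_span_le_of_forall fun a ha z hz => ?_
    refine mem_augmentationSpan_mul hZp hZc
      (mul_mem_centralSupported (centralDefectSet_of_sylow hZc) ha hz.1) fun x => ?_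
    exact sum_coeff_coset_eq_zero (mapDomain_mul_eq_zero hZp hZc ha hz.1 hz.2) x
  have h2 : ∀ k, M * centralNilpotents F H ^ k ≤ augmentationSpan F Z ^ k * M := by
    intro k
    induction k with
    | zero => simp
    | succ k ih =>
      calc M * centralNilpotents F H ^ (k + 1)
          = M * centralNilpotents F H ^ k * centralNilpotents F H := by rw [pow_succ, mul_assoc]
        _ ≤ augmentationSpan F Z ^ k * M * centralNilpotents F H := mul_le_mul' ih le_rfl
        _ = augmentationSpan F Z ^ k * (M * centralNilpotents F H) := mul_assoc _ _ _
        _ ≤ augmentationSpan F Z ^ k * (augmentationSpan F Z * M) := mul_le_mul' le_rfl h1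
        _ = _ := by rw [← mul_assoc, ← pow_succ]
  have h3 : augmentationSpan F Z ^ n = ⊥ := by
    have : (Set.range fun u : Z => (MonoidAlgebra.single (u : H) 1 - 1 : MonoidAlgebra F H)) =
        MonoidAlgebra.mapDomainRingHom F Z.subtype '' augmentationSet F Z := by
      rw [augmentationSet, ← Set.range_comp]
      congr 1
      ext1 u
      exact (mapDomainRingHom_single_sub_one Z.subtype u).symm
    rw [augmentationSpan, Submodule.span_pow, Submodule.span_eq_bot, this, ← Set.image_pow]
    rintro _ ⟨x, hx, rfl⟩
    rw [hn hx, map_zero]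
  exact le_bot_iff.mp ((h2 n).trans (by rw [h3]; simp))
/-- The Brauer map `FG → F C_G(P)`, which restricts coefficients to the centralizer of `P`. -/
noncomputable def brauerMap (F : Type*) {G : Type*} [Field F] [Group G] [Finite G]
    (P : Subgroup G) : MonoidAlgebra F G →ₗ[F]
      MonoidAlgebra F (Subgroup.centralizer (P : Set G)) where
  toFun a := MonoidAlgebra.ofCoeff (Finsupp.equivFunOnFinite.symm fun x => a.coeff x)
  map_add' a b := by ext x; rfl
  map_smul' r a := by ext x; rfl

theorem coeff_brauerMap {F G : Type*} [Field F] [Group G] [Finite G] (P : Subgroup G)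
    (a : MonoidAlgebra F G) (x : Subgroup.centralizer (P : Set G)) :
    (brauerMap F P a).coeff x = a.coeff x := rfl

theorem commute_of_mem_centralizer {G : Type*} [Group G] {P : Subgroup G} {x : G}
    (hx : x ∈ Subgroup.centralizer (P : Set G)) : ∀ q ∈ P, Commute q x :=
  fun q hq => Subgroup.mem_centralizer_iff.mp hx q hq

section Brauer

variable {F G : Type*} [Field F] [Group G] [Fintype G] {p : ℕ} [Fact p.Prime] [CharP F p]
  {P : Subgroup G}

theorem brauerMap_mul (hP : IsPGroup p P) {a b : MonoidAlgebra F G}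
    (ha : ∀ w, Commute a w) (hb : ∀ w, Commute b w) :
    brauerMap F P (a * b) = brauerMap F P a * brauerMap F P b := by
  ext g
  rw [coeff_brauerMap, coeff_mul_eq_sum_centralizer hP ha hb (commute_of_mem_centralizer g.2),
    coeff_mul_eq_sum]
  exact Finset.sum_subtype _ (fun x =>
    ⟨fun h => Subgroup.mem_centralizer_iff.mpr (Finset.mem_filter.mp h).2,
      fun h => Finset.mem_filter.mpr ⟨Finset.mem_univ _, commute_of_mem_centralizer h⟩⟩)
    (fun x => a.coeff x * b.coeff (x⁻¹ * g))

theorem brauerMap_one (P : Subgroup G) : brauerMap F P 1 = 1 := by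
  ext g
  rw [coeff_brauerMap, MonoidAlgebra.one_def, MonoidAlgebra.one_def]
  simp [Finsupp.single_apply, eq_comm]

theorem brauerMap_commute {a : MonoidAlgebra F G} (ha : ∀ w, Commute a w) (P : Subgroup G)
    (w : MonoidAlgebra F (Subgroup.centralizer (P : Set G))) : Commute (brauerMap F P a) w :=
  commute_of_coeff_conj (a := brauerMap F P a)
    (fun g h => coeff_conj_of_commute ha (g : G) (h : G)) w

theorem brauerMap_pow (hP : IsPGroup p P) {a : MonoidAlgebra F G} (ha : ∀ w, Commute a w) (n : ℕ) :
    brauerMap F P (a ^ n) = brauerMap F P a ^ n := by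
  induction n with
  | zero => simp [brauerMap_one]
  | succ n ih =>
    rw [pow_succ, pow_succ, brauerMap_mul hP (fun w => (ha w).pow_left n) ha, ih]

theorem mem_centralNilpotents_pow_of_mem (hP : IsPGroup p P) (n : ℕ) {t : MonoidAlgebra F G}
    (ht : t ∈ centralNilpotents F G ^ n) :
    (∀ w, Commute t w) ∧ brauerMap F P t ∈
      centralNilpotents F (Subgroup.centralizer (P : Set G)) ^ n := by
  have h1 : ∀ z ∈ centralNilpotents F G, (∀ w, Commute z w) ∧
      brauerMap F P z ∈ centralNilpotents F (Subgroup.centralizer (P : Set G)) := by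
    intro z hz
    induction hz using Submodule.span_induction with
    | mem z hz =>
      refine ⟨hz.1, Submodule.subset_span ⟨brauerMap_commute hz.1 P, ?_⟩⟩
      obtain ⟨k, hk⟩ := hz.2
      exact ⟨k, by rw [← brauerMap_pow hP hz.1, hk, map_zero]⟩
    | zero => exact ⟨Commute.zero_left, by simp⟩
    | add x y _ _ hx hy =>
      exact ⟨fun w => (hx.1 w).add_left (hy.1 w), by
        rw [map_add]; exact Submodule.add_mem _ hx.2 hy.2⟩
    | smul c x _ hx =>
      exact ⟨fun w => (hx.1 w).smul_left c, by
        rw [map_smul]; exact Submodule.smul_mem _ _ hx.2⟩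
  induction n generalizing t with
  | zero =>
    rw [pow_zero, Submodule.mem_one] at ht
    obtain ⟨r, rfl⟩ := ht
    refine ⟨Algebra.commutes r, ?_⟩
    rw [Algebra.algebraMap_eq_smul_one, map_smul, brauerMap_one, pow_zero]
    exact Submodule.smul_mem _ _ (Submodule.one_le.mp le_rfl)
  | succ n ih =>
    rw [pow_succ] at ht
    induction ht using Submodule.mul_induction_on' with
    | mem_mul_mem x hx z hz =>
      refine ⟨fun w => ((ih hx).1 w).mul_left ((h1 z hz).1 w), ?_⟩
      rw [brauerMap_mul hP (ih hx).1 (h1 z hz).1, pow_succ]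
      exact Submodule.mul_mem_mul (ih hx).2 (h1 z hz).2
    | add x _ y _ hx hy =>
      exact ⟨fun w => (hx.1 w).add_left (hy.1 w), by
        rw [map_add]; exact Submodule.add_mem _ hx.2 hy.2⟩

end Brauer

theorem JZ_le_centralNilpotents (F : Type) [Field F] (G : Type) [Group G] [Fintype G] :
    JZ F G ≤ centralNilpotents F G := by
  rintro _ ⟨z, hz, rfl⟩
  have : Module.Finite F (MonoidAlgebra F G) :=
    Module.Finite.of_basis (.ofRepr (MonoidAlgebra.coeffLinearEquiv F) : Module.Basis G F _)
  have : IsArtinianRing (Subalgebra.center F (MonoidAlgebra F G)) :=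
    isArtinian_of_tower F inferInstance
  obtain ⟨n, hn⟩ := IsArtinianRing.isNilpotent_jacobson_bot
    (R := Subalgebra.center F (MonoidAlgebra F G))
  refine Submodule.subset_span ⟨fun w => ((Subalgebra.mem_center_iff.mp z.2) w).symm, n, ?_⟩
  have h1 : z ^ n ∈ (Ideal.jacobson (⊥ : Ideal (Subalgebra.center F (MonoidAlgebra F G)))) ^ n :=
    Ideal.pow_mem_pow hz n
  rw [hn] at h1
  exact congrArg Subtype.val (show z ^ n = 0 from h1)

/-- The elements whose conjugacy class has a defect group in `𝒬`. -/
def classDefectSet {G : Type} [Group G] (p : ℕ) (𝒬 : Set (Subgroup G)) : Set G :=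
  {g | ∃ Q ∈ 𝒬, IsClassDefectGroup p Q (ConjClasses.mk g)}

theorem iSup_classIdeal_eq (F : Type) [Field F] {G : Type} [Group G] [Fintype G] (p : ℕ)
    (𝒬 : Set (Subgroup G)) :
    ⨆ Q ∈ 𝒬, classIdeal F p Q = centralSupported F (classDefectSet p 𝒬) := by
  apply le_antisymm
  · refine iSup₂_le fun Q hQ => Submodule.span_le.mpr ?_
    rintro _ ⟨K, hK, rfl⟩
    refine ⟨fun g h => ?_, fun g hg => ⟨Q, hQ, ?_⟩⟩
    · rw [coeff_classSum, coeff_classSum,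
        ConjClasses.mk_eq_mk_iff_isConj.mpr (isConj_iff.mpr ⟨h, rfl⟩ : IsConj g (h * g * h⁻¹))]
    · rw [coeff_classSum] at hg
      rwa [of_not_not fun h => hg (if_neg h)]
  · intro a ha
    rw [eq_sum_classSum ha.1]
    refine Submodule.sum_mem _ fun K _ => ?_
    by_cases h0 : a.coeff (Quotient.out K) = 0
    · rw [h0, zero_smul]; exact Submodule.zero_mem _
    · obtain ⟨Q, hQ, hQK⟩ := ha.2 _ h0
      rw [show ConjClasses.mk (Quotient.out K) = K from Quotient.out_eq K] at hQK
      exact Submodule.smul_mem _ _ (Submodule.mem_iSup_of_mem Q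
        (Submodule.mem_iSup_of_mem hQ (Submodule.subset_span ⟨K, hQK, rfl⟩)))

section Defect

variable {G : Type} [Group G] [Finite G] {p : ℕ} [Fact p.Prime] {P : Subgroup G}

/-- A `p`-group centralizing `x` is conjugate to a subgroup of `P` if `x` has a defect group
in `P`. -/
theorem exists_conj_mem_of_mem_classDefectSet {x : G} (hx : x ∈ classDefectSet p {Q | Q ≤ P})
    {T : Subgroup G} (hT : IsPGroup p T) (hTx : ∀ t ∈ T, Commute t x) :
    ∃ d : G, ∀ t ∈ T, d * t * d⁻¹ ∈ P := by
  obtain ⟨Q, hQP, y, hy, S, rfl⟩ := hx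
  obtain ⟨c, rfl⟩ := isConj_iff.mp
    (ConjClasses.mk_eq_mk_iff_isConj.mp (ConjClasses.mem_carrier_iff_mk_eq.mp hy)).symm
  let f : T →* Subgroup.centralizer {c * x * c⁻¹} :=
    ((MulAut.conj c).toMonoidHom.comp T.subtype).codRestrict _ fun t =>
      Subgroup.mem_centralizer_singleton_iff.mpr <| by
        have := (hTx t t.2).eq
        change c * t * c⁻¹ * (c * x * c⁻¹) = (c * x * c⁻¹) * (c * t * c⁻¹)
        calc c * t * c⁻¹ * (c * x * c⁻¹) = c * (t * x) * c⁻¹ := by group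
          _ = (c * x * c⁻¹) * (c * t * c⁻¹) := by rw [this]; group
  have hf : IsPGroup p f.range := hT.of_surjective f.rangeRestrict f.rangeRestrict_surjective
  obtain ⟨R, hR⟩ := hf.exists_le_sylow
  obtain ⟨e, he⟩ := MulAction.exists_smul_eq (Subgroup.centralizer {c * x * c⁻¹}) R S
  refine ⟨e * c, fun t ht => hQP ⟨e * f ⟨t, ht⟩ * e⁻¹, ?_, ?_⟩⟩
  · rw [← he]
    exact Subgroup.smul_mem_pointwise_smul _ (MulAut.conj e) _ (hR ⟨_, rfl⟩)
  · change (e : G) * (c * t * c⁻¹) * (e : G)⁻¹ = _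
    group

theorem mem_classDefectSet_of_conj_mem {g d : G} (R : Sylow p (Subgroup.centralizer {g}))
    (hd : ∀ r ∈ R, d * r * d⁻¹ ∈ P) : g ∈ classDefectSet p {Q | Q ≤ P} := by
  let f : Subgroup.centralizer {g} →* Subgroup.centralizer {d * g * d⁻¹} :=
    ((MulAut.conj d).toMonoidHom.comp (Subgroup.subtype _)).codRestrict _ fun t =>
      Subgroup.mem_centralizer_singleton_iff.mpr <| by
        have := Subgroup.mem_centralizer_singleton_iff.mp t.2
        change d * t * d⁻¹ * (d * g * d⁻¹) = (d * g * d⁻¹) * (d * t * d⁻¹)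
        calc d * t * d⁻¹ * (d * g * d⁻¹) = d * (t * g) * d⁻¹ := by group
          _ = (d * g * d⁻¹) * (d * t * d⁻¹) := by rw [this]; group
  have hf : Function.Surjective f := by
    rintro ⟨t, ht⟩
    refine ⟨⟨d⁻¹ * t * d, Subgroup.mem_centralizer_singleton_iff.mpr ?_⟩, Subtype.ext ?_⟩
    · have := Subgroup.mem_centralizer_singleton_iff.mp ht
      calc d⁻¹ * t * d * g = d⁻¹ * (t * (d * g * d⁻¹)) * d := by group
        _ = g * (d⁻¹ * t * d) := by rw [this]; group
    · change d * (d⁻¹ * t * d) * d⁻¹ = t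
      group
  refine ⟨_, ?_, d * g * d⁻¹, ?_, R.mapSurjective hf, rfl⟩
  · rintro _ ⟨_, ⟨r, hr, rfl⟩, rfl⟩
    exact hd r hr
  · exact ConjClasses.mem_carrier_iff_mk_eq.mpr
      (ConjClasses.mk_eq_mk_iff_isConj.mpr (isConj_iff.mpr ⟨d, rfl⟩)).symm

theorem mem_centralDefectSet_of_mem_classDefectSet (hP : IsPGroup p P)
    (x : Subgroup.centralizer (P : Set G)) (hx : (x : G) ∈ classDefectSet p {Q | Q ≤ P}) :
    x ∈ centralDefectSet p (P.subgroupOf (Subgroup.centralizer (P : Set G))) := by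
  rintro h hhx ⟨k, hk⟩
  have hz : IsPGroup p (Subgroup.zpowers (h : G)) := by
    rintro ⟨_, m, rfl⟩
    refine ⟨k, Subtype.ext ?_⟩
    change ((h : G) ^ m) ^ p ^ k = 1
    rw [← zpow_natCast, zpow_comm, zpow_natCast,
      show (h : G) ^ p ^ k = 1 from congrArg Subtype.val hk, one_zpow]
  have hT : IsPGroup p (P ⊔ Subgroup.zpowers (h : G) : Subgroup G) := by
    refine hP.to_sup_of_normal_left' hz ?_
    rw [Subgroup.zpowers_le]
    exact Subgroup.centralizer_le_normalizer _ h.2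
  have hTx : ∀ t ∈ P ⊔ Subgroup.zpowers (h : G), Commute t x := by
    have : P ⊔ Subgroup.zpowers (h : G) ≤ Subgroup.centralizer {(x : G)} := by
      refine sup_le (fun q hq => Subgroup.mem_centralizer_singleton_iff.mpr
        (Subgroup.mem_centralizer_iff.mp x.2 q hq)) ?_
      rw [Subgroup.zpowers_le]
      exact Subgroup.mem_centralizer_singleton_iff.mpr (congrArg Subtype.val hhx.eq)
    exact fun t ht => Subgroup.mem_centralizer_singleton_iff.mp (this ht)
  obtain ⟨d, hd⟩ := exists_conj_mem_of_mem_classDefectSet hx hT hTx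
  have hcard : Nat.card (P ⊔ Subgroup.zpowers (h : G) : Subgroup G) ≤ Nat.card P :=
    Nat.card_le_card_of_injective (fun t => ⟨d * t.1 * d⁻¹, hd t.1 t.2⟩) fun s t hst => by
      have := congrArg Subtype.val hst
      exact Subtype.ext (by simpa using this)
  have := Subgroup.eq_of_le_of_card_ge (le_sup_left : P ≤ P ⊔ Subgroup.zpowers (h : G)) hcard
  exact this.ge (Subgroup.mem_sup_right (Subgroup.mem_zpowers _))

end Defect

/-- If the augmentation ideal of `F Z(P)` has vanishing `n`-th power, then
`I_{≤P}(G) · J(Z(FG)) ^ n ≤ I_{<P}(G)`. -/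
theorem classIdealLE_mul_pow_le {F : Type} [Field F] {G : Type} [Group G] [Fintype G]
    {p : ℕ} [Fact p.Prime] [CharP F p] {P : Subgroup G} (hP : IsPGroup p P) {n : ℕ}
    (hn : augmentationSet F (Subgroup.center P) ^ n ⊆ {0}) :
    classIdealLE F p P * JZ F G ^ n ≤ classIdealLT F p P := by
  have hLE : classIdealLE F p P = centralSupported F (classDefectSet p {Q | Q ≤ P}) :=
    iSup_classIdeal_eq F p {Q | Q ≤ P}
  have hLT : classIdealLT F p P = centralSupported F (classDefectSet p {Q | Q < P}) :=
    iSup_classIdeal_eq F p {Q | Q < P}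
  let Z := P.subgroupOf (Subgroup.centralizer (P : Set G))
  have hZc : ∀ u ∈ Z, ∀ h, Commute u h := fun u hu h =>
    Subtype.ext (commute_of_mem_centralizer h.2 u hu)
  have hZp : IsPGroup p Z := hP.comap_of_injective _ Subtype.val_injective
  let f : Subgroup.center P →* Z :=
    { toFun := fun c => ⟨⟨c.1.1, fun q hq => congrArg Subtype.val
        (Subgroup.mem_center_iff.mp c.2 ⟨q, hq⟩)⟩, c.1.2⟩
      map_one' := rfl
      map_mul' := fun _ _ => rfl }
  have hf : Function.Surjective f := fun u =>
    ⟨⟨⟨u.1.1, u.2⟩, Subgroup.mem_center_iff.mpr fun q => Subtype.ext (u.1.2 q q.2)⟩, rfl⟩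
  have hbot := centralSupported_mul_pow_eq_bot hZp hZc (augmentationSet_pow_subset_of_hom f hf hn)
  rw [hLE, hLT, Submodule.mul_le]
  intro a ha t ht
  obtain ⟨htc, htb⟩ := mem_centralNilpotents_pow_of_mem hP n
    (pow_le_pow_left' (JZ_le_centralNilpotents F G) n ht)
  have hat : a * t ∈ centralSupported F (classDefectSet p {Q | Q ≤ P}) := by
    refine mul_mem_centralSupported (p := p) (fun x hx g Q hQ => ?_) ha htc
    obtain ⟨d, hd⟩ := exists_conj_mem_of_mem_classDefectSet hx
      (Q.isPGroup'.map (Subgroup.subtype _)) (by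
        rintro _ ⟨q, hq, rfl⟩
        exact hQ q hq)
    exact mem_classDefectSet_of_conj_mem Q fun r hr => hd r ⟨r, hr, rfl⟩
  have hbr : brauerMap F P (a * t) = 0 := by
    rw [brauerMap_mul hP (commute_of_mem_centralSupported ha) htc]
    have : brauerMap F P a ∈ centralSupported F (centralDefectSet p Z) :=
      ⟨fun g h => ha.1 g h, fun g hg =>
        mem_centralDefectSet_of_mem_classDefectSet hP g (ha.2 g hg)⟩
    have := Submodule.mul_mem_mul this htb
    rwa [hbot] at this
  refine ⟨hat.1, fun g hg => ?_⟩
  obtain ⟨Q, hQ, hQg⟩ := hat.2 g hg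
  refine ⟨Q, show Q < P from lt_of_le_of_ne hQ ?_, hQg⟩
  rintro rfl
  obtain ⟨x, hx, S, hS⟩ := hQg
  obtain ⟨c, rfl⟩ := isConj_iff.mp
    (ConjClasses.mk_eq_mk_iff_isConj.mp (ConjClasses.mem_carrier_iff_mk_eq.mp hx)).symm
  have hxc : c * g * c⁻¹ ∈ Subgroup.centralizer (Q : Set G) := by
    refine Subgroup.mem_centralizer_iff.mpr fun q hq => ?_
    rw [SetLike.mem_coe, hS] at hq
    obtain ⟨s, -, rfl⟩ := hq
    exact Subgroup.mem_centralizer_singleton_iff.mp s.2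
  apply hg
  rw [← hat.1 g c]
  exact congrArg (fun w => w.coeff ⟨_, hxc⟩) hbr

theorem classIdealLE_mul_pow_le_of_card_center_le {F : Type} [Field F] {G : Type} [Group G]
    [Fintype G] {p : ℕ} [Fact p.Prime] [CharP F p] {P : Subgroup G} (hP : IsPGroup p P) {n : ℕ}
    (hn : Nat.card (Subgroup.center P) ≤ n) :
    classIdealLE F p P * JZ F G ^ n ≤ classIdealLT F p P :=
  classIdealLE_mul_pow_le hP (augmentationSet_pow_subset_of_le hn
    (augmentationSet_pow_card_subset (hP.to_subgroup _)))

theorem Subgroup.lt_of_card_eq_pow {G : Type*} [Group G] [Finite G] {p m n : ℕ} {P Q : Subgroup G}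
    (h : Q < P) (hQ : Nat.card Q = p ^ m) (hP : Nat.card P = p ^ n) : m < n := by
  have hlt : Nat.card Q < Nat.card P :=
    (Subgroup.card_le_of_le h.le).lt_of_ne fun he => h.ne (Subgroup.eq_of_le_of_card_ge h.le he.ge)
  rw [hQ, hP] at hlt
  by_contra! hnm
  rcases Nat.eq_zero_or_pos p with rfl | hp
  · have h1 : 0 ^ m ≠ 0 := hQ ▸ Nat.card_pos.ne'
    have h2 : 0 ^ n ≠ 0 := hP ▸ Nat.card_pos.ne'
    simp_all
  · exact hlt.not_ge (Nat.pow_le_pow_right hp hnm)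

theorem classIdealLT_mul_le {F : Type} [Field F] {G : Type} [Group G] [Fintype G] {p : ℕ}
    {P : Subgroup G} {M N : Submodule F (MonoidAlgebra F G)}
    (h : ∀ Q < P, classIdealLE F p Q * M ≤ N) : classIdealLT F p P * M ≤ N := by
  rw [classIdealLT, Submodule.iSup_mul]
  refine iSup_le fun Q => ?_
  rw [Submodule.iSup_mul]
  refine iSup_le fun hQ => le_trans (mul_le_mul_left ?_ M) (h Q hQ)
  exact le_iSup₂_of_le Q le_rfl le_rfl

/-- `J(Z(FG)) ^ (1 + p + ⋯ + p ^ m)` annihilates `I_{≤P}(G)` if `|P| = p ^ m`. -/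
theorem classIdealLE_mul_pow_geom_sum_eq_bot {F : Type} [Field F] {G : Type} [Group G] [Fintype G]
    {p : ℕ} [Fact p.Prime] [CharP F p] {m n : ℕ} {P : Subgroup G} (hP : Nat.card P = p ^ m)
    (hn : ∑ i ∈ Finset.range (m + 1), p ^ i ≤ n) :
    classIdealLE F p P * JZ F G ^ n = ⊥ := by
  induction m using Nat.strong_induction_on generalizing n P with
  | _ m ih =>
    have hPp : IsPGroup p P := IsPGroup.of_card hP
    rw [Finset.sum_range_succ] at hn
    obtain ⟨k, rfl⟩ := Nat.exists_eq_add_of_le ((Nat.le_add_left _ _).trans hn)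
    rw [pow_add, ← mul_assoc, eq_bot_iff]
    refine (mul_le_mul_left (classIdealLE_mul_pow_le_of_card_center_le hPp
      ((Subgroup.card_le_card_group _).trans hP.le)) _).trans ?_
    refine classIdealLT_mul_le fun Q hQ => ?_
    obtain ⟨j, hj⟩ := IsPGroup.iff_card.mp (hPp.to_le hQ.le)
    have hjm : j < m := Subgroup.lt_of_card_eq_pow hQ hj hP
    exact (ih j hjm hj ((Finset.sum_le_sum_of_subset
      (Finset.range_mono hjm)).trans (by omega))).le

theorem card_center_le_of_not_commutative {P : Type*} [Group P] [Finite P] {p : ℕ} [Fact p.Prime]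
    {m : ℕ} (hP : Nat.card P = p ^ m) (h : ¬ ∀ x y : P, x * y = y * x) :
    2 ≤ m ∧ Nat.card (Subgroup.center P) ≤ p ^ (m - 2) := by
  have hp : p.Prime := Fact.out
  have hPp : IsPGroup p P := IsPGroup.of_card hP
  obtain ⟨j, hj⟩ := (IsPGroup.iff_card.mp (hPp.to_subgroup (Subgroup.center P)))
  obtain ⟨k, hk⟩ := (IsPGroup.iff_card.mp (hPp.to_quotient (Subgroup.center P)))
  have hjk : m = k + j := Nat.pow_right_injective hp.two_le <| by
    simpa [hP, hj, hk, pow_add] using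
      Subgroup.card_eq_card_quotient_mul_card_subgroup (Subgroup.center P)
  have hk2 : 2 ≤ k := by
    by_contra! hk2
    have : IsCyclic (P ⧸ Subgroup.center P) := by
      interval_cases k
      · have := (Nat.card_eq_one_iff_unique.mp hk).1
        infer_instance
      · exact isCyclic_of_prime_card (hk.trans (pow_one p))
    have := (QuotientGroup.mk' (Subgroup.center P)).isMulCommutative_of_isCyclic_of_ker_le_center
      (QuotientGroup.ker_mk' _).le
    exact h fun x y => mul_comm' x y
  exact ⟨by omega, hj ▸ Nat.pow_le_pow_right hp.pos (by omega)⟩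

theorem Subgroup.exists_maximal_lt_of_lt {G : Type*} [Group G] [Finite G] {P Q : Subgroup G}
    (h : Q < P) : ∃ E, Q ≤ E ∧ E < P ∧ ∀ R : Subgroup G, E < R → R ≤ P → R = P := by
  obtain ⟨E, hQE, hE⟩ := (Set.toFinite {R : Subgroup G | R < P}).exists_le_maximal h
  exact ⟨E, hQE, hE.prop, fun R hER hRP => by_contra fun hne =>
    (hE.le_of_ge (lt_of_le_of_ne hRP hne) hER.le).not_gt hER⟩

theorem augmentationSet_center_pow_subset {F P : Type*} [Field F] [Group P] [Finite P]
    {p : ℕ} [Fact p.Prime] [CharP F p] {m : ℕ} (hP : Nat.card P = p ^ m) (h : ¬ IsCyclic P) :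
    augmentationSet F (Subgroup.center P) ^ (p ^ (m - 1) + p - 1) ⊆ {0} := by
  have hp : p.Prime := Fact.out
  have hPp : IsPGroup p P := IsPGroup.of_card hP
  by_cases hc : ∀ x y : P, x * y = y * x
  · have htop : Subgroup.center P = ⊤ :=
      (Subgroup.eq_top_iff' _).mpr fun x => Subgroup.mem_center_iff.mpr fun y => hc y x
    have e : Subgroup.center P ≃* P := (MulEquiv.subgroupCongr htop).trans Subgroup.topEquiv
    exact augmentationSet_pow_subset_of_not_isCyclic (fun hcyc => h (e.isCyclic.mp hcyc))
      ((Nat.card_congr e.toEquiv).trans hP)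
  · obtain ⟨-, hm⟩ := card_center_le_of_not_commutative hP hc
    refine augmentationSet_pow_subset_of_le ?_
      (augmentationSet_pow_card_subset (hPp.to_subgroup (Subgroup.center P)))
    have := Nat.pow_le_pow_right hp.pos (show m - 2 ≤ m - 1 by omega)
    have := hp.pos
    omega

theorem classIdealLE_mul_pow_le_of_not_isCyclic {F : Type} [Field F] {G : Type} [Group G]
    [Fintype G] {p : ℕ} [Fact p.Prime] [CharP F p] {P : Subgroup G} {m n : ℕ}
    (hP : Nat.card P = p ^ m) (h : ¬ IsCyclic P) (hn : p ^ (m - 1) + p - 1 ≤ n) :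
    classIdealLE F p P * JZ F G ^ n ≤ classIdealLT F p P :=
  classIdealLE_mul_pow_le (IsPGroup.of_card hP) (augmentationSet_pow_subset_of_le hn
    (augmentationSet_center_pow_subset hP h))

end Lemmas

/-- If `D` is a non-abelian `p`-subgroup of `G` of order `p^d` all of whose maximal subgroups
are non-cyclic, then `I_{≤D}(G) · J(Z(FG))^(2p^(d-2) + p - 1 + (p^(d-1)-1)/(p-1)) = 0`. -/
theorem stmt3 (F : Type) [Field F] [IsAlgClosed F] (G : Type) [Group G] [Fintype G]
    (p : ℕ) [Fact p.Prime] [CharP F p]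
    (D : Subgroup G) (hD : IsPGroup p D) (d : ℕ) (hcard : Fintype.card ↥D = p ^ d)
    (hnonabelian : ¬ ∀ x y : ↥D, x * y = y * x)
    (hmax : ∀ Q : Subgroup G, Q < D → (∀ R : Subgroup G, Q < R → R ≤ D → R = D) →
      ¬ IsCyclic ↥Q) :
    classIdealLE F p D *
      (JZ F G) ^ (2 * p ^ (d - 2) + p - 1 + (p ^ (d - 1) - 1) / (p - 1)) = ⊥ := by
  have hp : p.Prime := Fact.out
  have hDcard : Nat.card D = p ^ d := Nat.card_eq_fintype_card.trans hcard
  obtain ⟨hd, hZ⟩ := card_center_le_of_not_commutative hDcard hnonabelian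
  have hexp : 2 * p ^ (d - 2) + p - 1 + (p ^ (d - 1) - 1) / (p - 1) =
      p ^ (d - 2) + ((p ^ (d - 2) + p - 1) + ∑ i ∈ Finset.range (d - 1), p ^ i) := by
    rw [Nat.geomSum_eq hp.two_le]
    have := hp.pos
    omega
  rw [hexp, pow_add, ← mul_assoc, eq_bot_iff]
  refine (mul_le_mul_left (classIdealLE_mul_pow_le_of_card_center_le hD hZ) _).trans ?_
  refine classIdealLT_mul_le fun Q hQ => ?_
  obtain ⟨E, hQE, hED, hE⟩ := Subgroup.exists_maximal_lt_of_lt hQ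
  have hEp : IsPGroup p E := hD.to_le hED.le
  obtain ⟨m, hm⟩ := IsPGroup.iff_card.mp hEp
  have hmd : m < d := Subgroup.lt_of_card_eq_pow hED hm hDcard
  have hexpE : p ^ (m - 1) + p - 1 ≤ p ^ (d - 2) + p - 1 := by
    have := Nat.pow_le_pow_right hp.pos (show m - 1 ≤ d - 2 by omega)
    omega
  have hQE' : classIdealLE F p Q ≤ classIdealLE F p E :=
    iSup₂_le fun R hR => le_iSup₂_of_le R (hR.trans hQE) le_rfl
  refine (mul_le_mul_left hQE' _).trans ?_
  rw [pow_add, ← mul_assoc]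
  refine (mul_le_mul_left (classIdealLE_mul_pow_le_of_not_isCyclic hm (hmax E hED hE) hexpE)
    _).trans ?_
  refine classIdealLT_mul_le fun R hR => ?_
  obtain ⟨j, hj⟩ := IsPGroup.iff_card.mp (hEp.to_le hR.le)
  have hjm : j < m := Subgroup.lt_of_card_eq_pow hR hj hm
  exact (classIdealLE_mul_pow_geom_sum_eq_bot hj
    (Finset.sum_le_sum_of_subset (Finset.range_mono (by omega)))).le
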